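/- Let (h, ⟨,⟩) be an n-dimensional real inner product space and D a skew-symmetric endomorphism of h. Define on g = h ⊕ RH the product: X•Y = ⟨X,Y⟩H, H•X = (1/2)X + D(X), X•H = 0 for X,Y ∈ h, and H•H = H. Then (g, •) is a left symmetric algebra and its Koszul form B satisfies B(X,Y) = (n/2 + 1)⟨X,Y⟩ for X,Y ∈ h, B(X,H) = 0, and B(H,H) = n/2 + 1; in particular B is positive definite. -/

import Mathlib

open RealInnerProductSpace

/-- Left multiplication of the product on `g = h ⊕ ℝH` defined by
`X•Y = ⟨X,Y⟩H`, `H•X = ½X + D X`, `X•H = 0`, `H•H = H` (elements of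
`h × ℝ` are written `(X, a) = X + aH`). -/
noncomputable def lmulCorOne {h : Type*} [NormedAddCommGroup h]
    [InnerProductSpace ℝ h] (D : h →ₗ[ℝ] h) (p : h × ℝ) :
    (h × ℝ) →ₗ[ℝ] (h × ℝ) :=
  LinearMap.prod
    (p.2 • (((2:ℝ)⁻¹ • LinearMap.id + D) ∘ₗ LinearMap.fst ℝ h ℝ))
    ((innerₛₗ ℝ p.1) ∘ₗ LinearMap.fst ℝ h ℝ + p.2 • LinearMap.snd ℝ h ℝ)

theorem trace_skew_aux {h : Type*} [NormedAddCommGroup h]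
    [InnerProductSpace ℝ h] [FiniteDimensional ℝ h]
    (D : h →ₗ[ℝ] h) (hD : ∀ X Y : h, ⟪D X, Y⟫ = -⟪D Y, X⟫) :
    LinearMap.trace ℝ h D = 0 := by
  rw [LinearMap.trace_eq_sum_inner D (stdOrthonormalBasis ℝ h)]
  apply Finset.sum_eq_zero
  intro i _
  have := hD (stdOrthonormalBasis ℝ h i) (stdOrthonormalBasis ℝ h i)
  rw [real_inner_comm]
  linarith

theorem trace_lmul_aux {h : Type*} [NormedAddCommGroup h]
    [InnerProductSpace ℝ h] [FiniteDimensional ℝ h]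
    (D : h →ₗ[ℝ] h) (hD : ∀ X Y : h, ⟪D X, Y⟫ = -⟪D Y, X⟫) (p : h × ℝ) :
    LinearMap.trace ℝ (h × ℝ) (lmulCorOne D p)
      = p.2 * ((Module.finrank ℝ h : ℝ) / 2 + 1) := by
  have e : lmulCorOne D p =
      LinearMap.prodMap (p.2 • ((2:ℝ)⁻¹ • LinearMap.id + D)) (p.2 • LinearMap.id)
      + LinearMap.inr ℝ h ℝ ∘ₗ ((innerₛₗ ℝ p.1) ∘ₗ LinearMap.fst ℝ h ℝ) := by
    apply LinearMap.ext
    intro q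
    ext <;> simp [lmulCorOne]
    ring
  have z : ((innerₛₗ ℝ p.1) ∘ₗ LinearMap.fst ℝ h ℝ) ∘ₗ LinearMap.inr ℝ h ℝ = 0 := by
    ext
    simp
  rw [e, map_add, LinearMap.trace_comp_comm', z, LinearMap.trace_prodMap']
  simp only [map_smul, map_add, trace_skew_aux D hD, LinearMap.trace_id, map_zero,
    Module.finrank_self, smul_eq_mul]
  push_cast
  ring

/-- For a skew-symmetric `D` on an `n`-dimensional real inner product space
`h`, the product on `g = h ⊕ ℝH` given by `X•Y = ⟨X,Y⟩H`, `H•X = ½X + D X`,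
`X•H = 0`, `H•H = H` is left symmetric and its Koszul form is
`(n/2 + 1)⟨,⟩` on `h`, `0` on `h × ℝH`, and `n/2 + 1` on `H`; in
particular it is positive definite. -/
theorem corollary_ex_one (h : Type*) [NormedAddCommGroup h]
    [InnerProductSpace ℝ h] [FiniteDimensional ℝ h]
    (n : ℕ) (hn : Module.finrank ℝ h = n)
    (D : h →ₗ[ℝ] h) (hD : ∀ X Y : h, ⟪D X, Y⟫ = -⟪D Y, X⟫) :
    (∀ p q : h × ℝ, lmulCorOne D p q
      = (p.2 • ((2:ℝ)⁻¹ • q.1 + D q.1), ⟪p.1, q.1⟫ + p.2 * q.2)) ∧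
    (∀ p q r : h × ℝ,
      lmulCorOne D (lmulCorOne D p q) r - lmulCorOne D p (lmulCorOne D q r)
        = lmulCorOne D (lmulCorOne D q p) r
          - lmulCorOne D q (lmulCorOne D p r)) ∧
    (∀ X Y : h, LinearMap.trace ℝ (h × ℝ)
        (lmulCorOne D (lmulCorOne D (X, 0) (Y, 0)))
      = ((n : ℝ) / 2 + 1) * ⟪X, Y⟫) ∧
    (∀ X : h, LinearMap.trace ℝ (h × ℝ)
        (lmulCorOne D (lmulCorOne D (X, 0) ((0 : h), (1 : ℝ)))) = 0) ∧
    (LinearMap.trace ℝ (h × ℝ)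
        (lmulCorOne D (lmulCorOne D ((0 : h), (1 : ℝ)) ((0 : h), (1 : ℝ))))
      = (n : ℝ) / 2 + 1) ∧
    (∀ p : h × ℝ, p ≠ 0 →
      0 < LinearMap.trace ℝ (h × ℝ) (lmulCorOne D (lmulCorOne D p p))) := by
  have hm : ∀ p q : h × ℝ, lmulCorOne D p q
      = (p.2 • ((2:ℝ)⁻¹ • q.1 + D q.1), ⟪p.1, q.1⟫ + p.2 * q.2) := by
    intro p q
    ext <;> simp [lmulCorOne]
  refine ⟨hm, ?_, ?_, ?_, ?_, ?_⟩
  · rintro ⟨X, a⟩ ⟨Y, b⟩ ⟨Z, c⟩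
    simp only [hm]
    have h1 := hD X Z
    have h2 := hD Y Z
    have h3 := hD X Y
    rw [real_inner_comm] at h1 h2 h3
    have c1 := real_inner_comm X Y
    have e1 := real_inner_comm X (D Z)
    have e2 := real_inner_comm Y (D Z)
    have e3 := real_inner_comm X (D Y)
    have e4 := real_inner_comm Z (D X)
    have e5 := real_inner_comm Z (D Y)
    have e6 := real_inner_comm Y (D X)
    ext
    · simp only [Prod.fst_sub, map_smul, map_add, c1]
      module
    · simp only [Prod.snd_sub, inner_add_left, inner_add_right, real_inner_smul_left,
        real_inner_smul_right]
      grind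
  · intro X Y
    rw [trace_lmul_aux D hD, hm, hn]
    simp [mul_comm]
  · intro X
    rw [trace_lmul_aux D hD, hm]
    simp
  · rw [trace_lmul_aux D hD, hm, hn]
    simp
  · intro p hp
    rw [trace_lmul_aux D hD, hm]
    apply mul_pos _ (by positivity)
    show 0 < ⟪p.1, p.1⟫ + p.2 * p.2
    by_cases h1 : p.1 = 0
    · have h2 : p.2 ≠ 0 := fun h2 => hp (Prod.ext h1 h2)
      rw [h1, inner_zero_left, zero_add]
      exact mul_self_pos.mpr h2
    · have := real_inner_self_pos.mpr h1
      nlinarith [mul_self_nonneg p.2]
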